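/- arXiv:1806.09000 — 8 statements merged into one kernel-verified Lean document; each statement's English description precedes it below -/
import Mathlib

section
/- Let (X, 𝒳) be a measurable space, let π be a probability measure on X, and let P_1, …, P_n be Markov kernels on X, each π-reversible. Then for any measurable weight function ω : X → Δ_n with ω_i(x) > 0 for all i and x, the locally informed kernel P*_ω is π-reversible. -/
open MeasureTheory ProbabilityTheory ENNReal

/-- The locally informed kernel `P*_ω(x, A)` built from the Markov kernels `P i` and the
state-dependent weight function `ω`:
`P*_ω(x, A) = Σ_i ω_i(x) [ ∫_A min(1, ω_i(y)/ω_i(x)) P_i(x, dy)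
                           + 1_A(x) (1 − ∫_X min(1, ω_i(y)/ω_i(x)) P_i(x, dy)) ]`. -/
noncomputable def locallyInformedKernel {X : Type*} [MeasurableSpace X] {n : ℕ}
    (P : Fin n → Kernel X X) (ω : X → Fin n → ℝ) (x : X) (A : Set X) : ℝ≥0∞ :=
  ∑ i : Fin n, ENNReal.ofReal (ω x i) *
    ((∫⁻ y in A, ENNReal.ofReal (min 1 (ω y i / ω x i)) ∂(P i x)) +
      A.indicator (fun _ => (1 : ℝ≥0∞)) x *
        (1 - ∫⁻ y, ENNReal.ofReal (min 1 (ω y i / ω x i)) ∂(P i x)))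

lemma compProd_map_swap_of_setLIntegral_comm {X : Type*} [MeasurableSpace X]
    {π : Measure X} [IsFiniteMeasure π] {κ : Kernel X X} [IsMarkovKernel κ]
    (hκ : ∀ A B : Set X, MeasurableSet A → MeasurableSet B →
      ∫⁻ x in A, κ x B ∂π = ∫⁻ x in B, κ x A ∂π) :
    (π ⊗ₘ κ).map Prod.swap = π ⊗ₘ κ := by
  refine Measure.ext_prod fun {s t} hs ht => ?_
  rw [Measure.map_apply measurable_swap (hs.prod ht), Set.preimage_swap_prod,
    Measure.compProd_apply_prod ht hs, Measure.compProd_apply_prod hs ht]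
  exact hκ t s ht hs

lemma setLIntegral_setLIntegral_comm_of_symm {X : Type*} [MeasurableSpace X]
    {π : Measure X} [IsFiniteMeasure π] {κ : Kernel X X} [IsMarkovKernel κ]
    (hκ : ∀ A B : Set X, MeasurableSet A → MeasurableSet B →
      ∫⁻ x in A, κ x B ∂π = ∫⁻ x in B, κ x A ∂π)
    {g : X × X → ℝ≥0∞} (hg : Measurable g) (hsymm : ∀ z, g z.swap = g z)
    {A B : Set X} (hA : MeasurableSet A) (hB : MeasurableSet B) :
    ∫⁻ x in A, ∫⁻ y in B, g (x, y) ∂(κ x) ∂π = ∫⁻ x in B, ∫⁻ y in A, g (x, y) ∂(κ x) ∂π := by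
  rw [← Measure.setLIntegral_compProd hg hA hB, ← Measure.setLIntegral_compProd hg hB hA]
  conv_lhs => rw [← compProd_map_swap_of_setLIntegral_comm hκ]
  rw [setLIntegral_map (hA.prod hB) hg measurable_swap, Set.preimage_swap_prod]
  simp only [hsymm]

lemma ofReal_mul_ofReal_min_one_div {a b : ℝ} (ha : 0 < a) :
    ENNReal.ofReal a * ENNReal.ofReal (min 1 (b / a)) = ENNReal.ofReal (min a b) := by
  rw [← ENNReal.ofReal_mul ha.le, mul_min_of_nonneg _ _ ha.le, mul_one, mul_div_cancel₀ _ ha.ne']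

/-- If `P_1, …, P_n` are `π`-reversible Markov kernels and `ω : X → Δ_n` is a measurable
weight function with `ω_i(x) > 0` everywhere, then the locally informed kernel `P*_ω` is
`π`-reversible, i.e. the measure `A × B ↦ ∫_A P*_ω(x, B) π(dx)` is symmetric. -/
theorem locallyInformed_reversible
    {X : Type*} [MeasurableSpace X]
    (π : Measure X) [IsProbabilityMeasure π]
    {n : ℕ} (P : Fin n → Kernel X X) [∀ i, IsMarkovKernel (P i)]
    (hrev : ∀ i : Fin n, ∀ A B : Set X, MeasurableSet A → MeasurableSet B →
      ∫⁻ x in A, P i x B ∂π = ∫⁻ x in B, P i x A ∂π)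
    (ω : X → Fin n → ℝ)
    (hωmeas : ∀ i : Fin n, Measurable fun x => ω x i)
    (hωpos : ∀ (x : X) (i : Fin n), 0 < ω x i)
    (hωsum : ∀ x : X, ∑ i : Fin n, ω x i = 1) :
    ∀ A B : Set X, MeasurableSet A → MeasurableSet B →
      ∫⁻ x in A, locallyInformedKernel P ω x B ∂π =
        ∫⁻ x in B, locallyInformedKernel P ω x A ∂π := by
  intro A B hA hB
  have hratio (i : Fin n) :
      Measurable fun z : X × X => ENNReal.ofReal (min 1 (ω z.2 i / ω z.1 i)) := by
    have := hωmeas i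
    fun_prop
  have hmove (i : Fin n) {S : Set X} (hS : MeasurableSet S) :
      Measurable fun x => ∫⁻ y in S, ENNReal.ofReal (min 1 (ω y i / ω x i)) ∂(P i x) :=
    (hratio i).setLIntegral_kernel_prod_right hS
  have hall (i : Fin n) :
      Measurable fun x => ∫⁻ y, ENNReal.ofReal (min 1 (ω y i / ω x i)) ∂(P i x) :=
    (hratio i).lintegral_kernel_prod_right'
  have hweight (i : Fin n) : Measurable fun x => ENNReal.ofReal (ω x i) :=
    (hωmeas i).ennreal_ofReal
  have hmove_eq (i : Fin n) (x : X) (S : Set X) :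
      ENNReal.ofReal (ω x i) * ∫⁻ y in S, ENNReal.ofReal (min 1 (ω y i / ω x i)) ∂(P i x) =
        ∫⁻ y in S, ENNReal.ofReal (min (ω x i) (ω y i)) ∂(P i x) := by
    rw [← lintegral_const_mul' _ _ ENNReal.ofReal_ne_top]
    simp only [ofReal_mul_ofReal_min_one_div (hωpos x i)]
  have hexpand {S T : Set X} (hT : MeasurableSet T) :
      ∫⁻ x in S, locallyInformedKernel P ω x T ∂π =
        ∑ i : Fin n, (∫⁻ x in S, ∫⁻ y in T, ENNReal.ofReal (min (ω x i) (ω y i)) ∂(P i x) ∂π +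
          ∫⁻ x in T ∩ S, ENNReal.ofReal (ω x i) *
            (1 - ∫⁻ y, ENNReal.ofReal (min 1 (ω y i / ω x i)) ∂(P i x)) ∂π) := by
    have hind : Measurable (T.indicator fun _ : X => (1 : ℝ≥0∞)) := measurable_const.indicator hT
    unfold locallyInformedKernel
    rw [lintegral_finsetSum]
    swap
    · exact fun i _ => (hweight i).mul
        ((hmove i hT).add (hind.mul (measurable_const.sub (hall i))))
    refine Finset.sum_congr rfl fun i _ => ?_
    simp only [mul_add]
    rw [lintegral_add_left]
    swap
    · exact (hweight i).mul (hmove i hT)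
    simp only [hmove_eq, ← setLIntegral_indicator hT]
    congr 1
    refine lintegral_congr fun x => ?_
    by_cases hx : x ∈ T <;> simp [hx]
  rw [hexpand hB, hexpand hA, Set.inter_comm B A]
  refine Finset.sum_congr rfl fun i _ => ?_
  congr 1
  have := hωmeas i
  exact setLIntegral_setLIntegral_comm_of_symm (hrev i)
    (g := fun z => ENNReal.ofReal (min (ω z.1 i) (ω z.2 i))) (by fun_prop)
    (fun z => by simp [min_comm]) hA hB
end

section
/- Let (X, 𝒳) be a measurable space, let π be a probability measure on X, and let P_1, …, P_n be Markov kernels on X, each π-reversible. Then for any measurable weight function ω : X → Δ_n with ω_i(x) > 0 for all i and x, the locally informed kernel P*_ω is π-invariant, i.e. ∫_X P*_ω(x, A) π(dx) = π(A) for every A ∈ 𝒳. -/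
open MeasureTheory ProbabilityTheory ENNReal

namespace ProbabilityTheory.Kernel.IsReversible

variable {X : Type*} [MeasurableSpace X] {π : Measure X} {κ : Kernel X X}

theorem map_swap_compProd [IsFiniteMeasure π] [IsMarkovKernel κ] (hκ : IsReversible κ π) :
    (π ⊗ₘ κ).map Prod.swap = π ⊗ₘ κ := by
  have : IsFiniteMeasure ((π ⊗ₘ κ).map Prod.swap) := Measure.isFiniteMeasure_map _ _
  refine Measure.ext_prod fun {s t} hs ht => ?_
  rw [Measure.map_apply measurable_swap (hs.prod ht), Set.preimage_swap_prod,
    Measure.compProd_apply_prod ht hs, Measure.compProd_apply_prod hs ht]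
  exact hκ ht hs

theorem setLIntegral_setLIntegral_swap [IsFiniteMeasure π] [IsMarkovKernel κ]
    (hκ : IsReversible κ π) {f : X × X → ℝ≥0∞} (hf : Measurable f) {s t : Set X}
    (hs : MeasurableSet s) (ht : MeasurableSet t) :
    ∫⁻ x in s, ∫⁻ y in t, f (x, y) ∂(κ x) ∂π = ∫⁻ x in t, ∫⁻ y in s, f (y, x) ∂(κ x) ∂π := by
  rw [← Measure.setLIntegral_compProd hf hs ht, ← hκ.map_swap_compProd,
    setLIntegral_map (hs.prod ht) hf measurable_swap, Set.preimage_swap_prod]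
  exact Measure.setLIntegral_compProd (hf.comp measurable_swap) ht hs

/-- The Metropolis-type flow with weight `w` leaves the measure with density `w` invariant. -/
theorem lintegral_metropolis [IsFiniteMeasure π] [IsMarkovKernel κ]
    (hκ : IsReversible κ π) {w : X → ℝ} (hw : Measurable w) (hpos : ∀ x, 0 < w x)
    {A : Set X} (hA : MeasurableSet A) :
    ∫⁻ x, ENNReal.ofReal (w x) * ((∫⁻ y in A, ENNReal.ofReal (min 1 (w y / w x)) ∂(κ x)) +
      A.indicator (fun _ => (1 : ℝ≥0∞)) x *
        (1 - ∫⁻ y, ENNReal.ofReal (min 1 (w y / w x)) ∂(κ x))) ∂π =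
      ∫⁻ x in A, ENNReal.ofReal (w x) ∂π := by
  have hm : Measurable fun p : X × X => ENNReal.ofReal (min (w p.1) (w p.2)) := by fun_prop
  have hflow (x : X) (B : Set X) :
      ENNReal.ofReal (w x) * ∫⁻ y in B, ENNReal.ofReal (min 1 (w y / w x)) ∂(κ x) =
        ∫⁻ y in B, ENNReal.ofReal (min (w x) (w y)) ∂(κ x) := by
    rw [← lintegral_const_mul _ (by fun_prop)]
    refine lintegral_congr fun y => ?_
    rw [← ENNReal.ofReal_mul (hpos x).le, mul_min_of_nonneg _ _ (hpos x).le, mul_one,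
      mul_div_cancel₀ _ (hpos x).ne']
  have hflow_univ (x : X) := hflow x Set.univ
  simp only [Measure.restrict_univ] at hflow_univ
  have hle (x : X) : ∫⁻ y, ENNReal.ofReal (min (w x) (w y)) ∂(κ x) ≤ ENNReal.ofReal (w x) := by
    calc _ ≤ ∫⁻ _, ENNReal.ofReal (w x) ∂(κ x) :=
          lintegral_mono fun y => ENNReal.ofReal_le_ofReal (min_le_left _ _)
      _ = _ := by simp
  have hterm (x : X) : ENNReal.ofReal (w x) *
      ((∫⁻ y in A, ENNReal.ofReal (min 1 (w y / w x)) ∂(κ x)) +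
        A.indicator (fun _ => (1 : ℝ≥0∞)) x *
          (1 - ∫⁻ y, ENNReal.ofReal (min 1 (w y / w x)) ∂(κ x))) =
      (∫⁻ y in A, ENNReal.ofReal (min (w x) (w y)) ∂(κ x)) + A.indicator (fun x =>
        ENNReal.ofReal (w x) - ∫⁻ y, ENNReal.ofReal (min (w x) (w y)) ∂(κ x)) x := by
    rw [mul_add, hflow]
    by_cases hx : x ∈ A
    · simp only [Set.indicator_of_mem hx, one_mul]
      rw [ENNReal.mul_sub fun _ _ => ENNReal.ofReal_ne_top, mul_one, hflow_univ]
    · simp [Set.indicator_of_notMem hx]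
  have hstay : Measurable fun x => ∫⁻ y, ENNReal.ofReal (min (w x) (w y)) ∂(κ x) :=
    hm.lintegral_kernel_prod_right'
  have hswap : ∫⁻ x, ∫⁻ y in A, ENNReal.ofReal (min (w x) (w y)) ∂(κ x) ∂π =
      ∫⁻ x in A, ∫⁻ y, ENNReal.ofReal (min (w x) (w y)) ∂(κ x) ∂π := by
    have h := hκ.setLIntegral_setLIntegral_swap hm MeasurableSet.univ hA
    simp only [Measure.restrict_univ] at h
    rw [h]
    simp only [min_comm]
  rw [lintegral_congr hterm, lintegral_add_right _ ((by fun_prop : Measurable _).indicator hA), lintegral_indicator hA,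
    hswap, ← lintegral_add_left hstay]
  exact lintegral_congr fun x => add_tsub_cancel_of_le (hle x)

end ProbabilityTheory.Kernel.IsReversible

/-- If `P_1, …, P_n` are `π`-reversible Markov kernels and `ω : X → Δ_n` is a measurable
weight function with `ω_i(x) > 0` everywhere, then the locally informed kernel `P*_ω` is
`π`-invariant: `∫_X P*_ω(x, A) π(dx) = π(A)` for every measurable `A`. -/
theorem locallyInformed_invariant
    {X : Type*} [MeasurableSpace X]
    (π : Measure X) [IsProbabilityMeasure π]
    {n : ℕ} (P : Fin n → Kernel X X) [∀ i, IsMarkovKernel (P i)]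
    (hrev : ∀ i : Fin n, ∀ A B : Set X, MeasurableSet A → MeasurableSet B →
      ∫⁻ x in A, P i x B ∂π = ∫⁻ x in B, P i x A ∂π)
    (ω : X → Fin n → ℝ)
    (hωmeas : ∀ i : Fin n, Measurable fun x => ω x i)
    (hωpos : ∀ (x : X) (i : Fin n), 0 < ω x i)
    (hωsum : ∀ x : X, ∑ i : Fin n, ω x i = 1) :
    ∀ A : Set X, MeasurableSet A →
      ∫⁻ x, locallyInformedKernel P ω x A ∂π = π A := by
  intro A hA
  have hmeas (i : Fin n) : Measurable fun x => ENNReal.ofReal (ω x i) := by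
    have := hωmeas i
    fun_prop
  have hratio (i : Fin n) :
      Measurable fun p : X × X => ENNReal.ofReal (min 1 (ω p.2 i / ω p.1 i)) := by
    have h₁ : Measurable fun p : X × X => ω p.1 i := (hωmeas i).comp measurable_fst
    have h₂ : Measurable fun p : X × X => ω p.2 i := (hωmeas i).comp measurable_snd
    exact (measurable_const.min (h₂.div h₁)).ennreal_ofReal
  unfold locallyInformedKernel
  rw [lintegral_finsetSum _ fun i _ => ?_]
  · calc _ = ∑ i, ∫⁻ x in A, ENNReal.ofReal (ω x i) ∂π :=
          Finset.sum_congr rfl fun i _ =>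
            Kernel.IsReversible.lintegral_metropolis (fun s t => hrev i s t) (hωmeas i)
              (fun x => hωpos x i) hA
      _ = ∫⁻ x in A, ∑ i, ENNReal.ofReal (ω x i) ∂π :=
          (lintegral_finsetSum _ fun i _ => hmeas i).symm
      _ = π A := by
          simp [← ENNReal.ofReal_sum_of_nonneg fun i _ => (hωpos _ i).le, hωsum]
  · have hA' : Measurable fun x => ∫⁻ y in A, ENNReal.ofReal (min 1 (ω y i / ω x i)) ∂(P i x) := by
      simpa only [Kernel.restrict_apply] using
        (hratio i).lintegral_kernel_prod_right' (κ := (P i).restrict hA)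
    exact (hmeas i).mul (hA'.add ((measurable_const.indicator hA).mul
      (measurable_const.sub (hratio i).lintegral_kernel_prod_right')))
end

section
/- In the Metropolis–Hastings density setting, for any measurable weight function ω : X → Δ_n with ω_i(x) > 0 for all i and x, the kernel P̄_ω of Algorithm 2 is π-reversible. -/
open MeasureTheory ProbabilityTheory ENNReal

/-- The kernel of Algorithm 2 in the Metropolis–Hastings density setting:
`P̄_ω(x, A) = Σ_i ω_i(x) [ ∫_A γ̄_i(x,y) q_i(x,y) λ(dy)
                           + 1_A(x)(1 − ∫_X γ̄_i(x,y) q_i(x,y) λ(dy)) ]`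
with `γ̄_i(x,y) = min(1, (p(y) q_i(y,x) ω_i(y)) / (p(x) q_i(x,y) ω_i(x)))`. -/
noncomputable def algorithm2Kernel {X : Type*} [MeasurableSpace X] {n : ℕ}
    (lam : Measure X) (p : X → ℝ) (q : Fin n → X → X → ℝ) (ω : X → Fin n → ℝ)
    (x : X) (A : Set X) : ℝ≥0∞ :=
  ∑ i : Fin n, ENNReal.ofReal (ω x i) *
    ((∫⁻ y in A, ENNReal.ofReal
        (min 1 ((p y * q i y x * ω y i) / (p x * q i x y * ω x i)) * q i x y) ∂lam) +
      A.indicator (fun _ => (1 : ℝ≥0∞)) x *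
        (1 - ∫⁻ y, ENNReal.ofReal
          (min 1 ((p y * q i y x * ω y i) / (p x * q i x y * ω x i)) * q i x y) ∂lam))

/-- A kernel made of a symmetric off-diagonal part and a part concentrated on the diagonal is
reversible. -/
theorem lintegral_symm_add_indicator_comm {X : Type*} [MeasurableSpace X]
    (lam : Measure X) [SFinite lam] {g : X → X → ℝ≥0∞}
    (hg : Measurable (Function.uncurry g)) (hsymm : ∀ x y, g x y = g y x)
    (r : X → ℝ≥0∞) {A B : Set X} (hA : MeasurableSet A) (hB : MeasurableSet B) :
    ∫⁻ x in A, ((∫⁻ y in B, g x y ∂lam) + B.indicator r x) ∂lam =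
      ∫⁻ x in B, ((∫⁻ y in A, g x y ∂lam) + A.indicator r x) ∂lam := by
  rw [lintegral_add_left hg.lintegral_prod_right, lintegral_add_left hg.lintegral_prod_right,
    setLIntegral_indicator hB, setLIntegral_indicator hA, Set.inter_comm B A,
    lintegral_lintegral_swap hg.aemeasurable]
  simp_rw [hsymm]

/-- The Metropolis–Hastings acceptance ratio symmetrizes the flow. -/
theorem mul_min_one_div_mul {a b c u v : ℝ} (ha : 0 < a) (hb : 0 < b) (hc : 0 < c) :
    a * (b * (min 1 (u * v / (a * c * b)) * c)) = min (a * c * b) (u * v) := by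
  have h : 0 < a * c * b := by positivity
  calc a * (b * (min 1 (u * v / (a * c * b)) * c))
      = (a * c * b) * min 1 (u * v / (a * c * b)) := by ring
    _ = min (a * c * b) (u * v) := by
      rw [mul_min_of_nonneg _ _ h.le, mul_one, mul_div_cancel₀ _ h.ne']

/-- In the Metropolis–Hastings density setting (σ-finite `λ`, target `π` with strictly
positive density `p` w.r.t. `λ`, positive proposal densities `q_i`), for any measurable
weight function `ω : X → Δ_n` with `ω_i(x) > 0`, the kernel `P̄_ω` of Algorithm 2 is
`π`-reversible. -/
theorem algorithm2_reversible
    {X : Type*} [MeasurableSpace X]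
    (lam : Measure X) [SigmaFinite lam]
    (p : X → ℝ) (hpmeas : Measurable p) (hppos : ∀ x, 0 < p x)
    (π : Measure X) [IsProbabilityMeasure π]
    (hπ : π = lam.withDensity fun x => ENNReal.ofReal (p x))
    {n : ℕ} (q : Fin n → X → X → ℝ)
    (hqmeas : ∀ i, Measurable (Function.uncurry (q i)))
    (hqpos : ∀ i x y, 0 < q i x y)
    (hqmarkov : ∀ i x, ∫⁻ y, ENNReal.ofReal (q i x y) ∂lam = 1)
    (ω : X → Fin n → ℝ)
    (hωmeas : ∀ i : Fin n, Measurable fun x => ω x i)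
    (hωpos : ∀ (x : X) (i : Fin n), 0 < ω x i)
    (hωsum : ∀ x : X, ∑ i : Fin n, ω x i = 1) :
    ∀ A B : Set X, MeasurableSet A → MeasurableSet B →
      ∫⁻ x in A, algorithm2Kernel lam p q ω x B ∂π =
        ∫⁻ x in B, algorithm2Kernel lam p q ω x A ∂π := by
  intro A B hA hB
  let f : Fin n → X → X → ℝ≥0∞ := fun i x y => ENNReal.ofReal
    (min 1 ((p y * q i y x * ω y i) / (p x * q i x y * ω x i)) * q i x y)
  let g : Fin n → X → X → ℝ≥0∞ := fun i x y => ENNReal.ofReal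
    (min (p x * q i x y * ω x i) (p y * q i y x * ω y i))
  let r : Fin n → X → ℝ≥0∞ := fun i x =>
    ENNReal.ofReal (p x) * (ENNReal.ofReal (ω x i) * (1 - ∫⁻ y, f i x y ∂lam))
  have hflow (i : Fin n) : Measurable fun z : X × X => p z.1 * q i z.1 z.2 * ω z.1 i :=
    ((hpmeas.comp measurable_fst).mul (hqmeas i)).mul ((hωmeas i).comp measurable_fst)
  have hflow' (i : Fin n) : Measurable fun z : X × X => p z.2 * q i z.2 z.1 * ω z.2 i :=
    (hflow i).comp measurable_swap
  have hf (i : Fin n) : Measurable (Function.uncurry (f i)) :=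
    ((measurable_const.min ((hflow' i).div (hflow i))).mul (hqmeas i)).ennreal_ofReal
  have hg (i : Fin n) : Measurable (Function.uncurry (g i)) :=
    ((hflow i).min (hflow' i)).ennreal_ofReal
  have hr (i : Fin n) : Measurable (r i) :=
    hpmeas.ennreal_ofReal.mul ((hωmeas i).ennreal_ofReal.mul
      (measurable_const.sub (hf i).lintegral_prod_right))
  have hgf (i : Fin n) (x y : X) :
      ENNReal.ofReal (p x) * (ENNReal.ofReal (ω x i) * f i x y) = g i x y := by
    rw [← ENNReal.ofReal_mul (hωpos x i).le, ← ENNReal.ofReal_mul (hppos x).le,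
      mul_min_one_div_mul (hppos x) (hωpos x i) (hqpos i x y)]
  have hkernel (x : X) (C : Set X) :
      ENNReal.ofReal (p x) * algorithm2Kernel lam p q ω x C =
        ∑ i, ((∫⁻ y in C, g i x y ∂lam) + C.indicator (r i) x) := by
    rw [algorithm2Kernel, Finset.mul_sum]
    refine Finset.sum_congr rfl fun i _ => ?_
    rw [mul_add, mul_add]
    congr 1
    · simp_rw [← hgf]
      rw [lintegral_const_mul' _ _ ENNReal.ofReal_ne_top,
        lintegral_const_mul' _ _ ENNReal.ofReal_ne_top]
    · by_cases hx : x ∈ C <;> simp [hx, r, f]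
  have hint (C D : Set X) (hC : MeasurableSet C) (hD : MeasurableSet D) :
      ∫⁻ x in C, algorithm2Kernel lam p q ω x D ∂π =
        ∑ i, ∫⁻ x in C, ((∫⁻ y in D, g i x y ∂lam) + D.indicator (r i) x) ∂lam := by
    rw [hπ, setLIntegral_withDensity_eq_setLIntegral_mul_non_measurable _
      hpmeas.ennreal_ofReal _ hC (by simp)]
    simp_rw [Pi.mul_apply, hkernel]
    exact lintegral_finsetSum _ fun i _ =>
      (hg i).lintegral_prod_right.add ((hr i).indicator hD)
  rw [hint A B hA hB, hint B A hB hA]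
  exact Finset.sum_congr rfl fun i _ =>
    lintegral_symm_add_indicator_comm lam (hg i) (fun x y => by simp only [g, min_comm]) (r i) hA hB
end

section
/- In the Metropolis–Hastings density setting, for any measurable weight function ω : X → Δ_n with ω_i(x) > 0 for all i and x, the kernel P̄_ω of Algorithm 2 dominates the kernel P_ω of Algorithm 1 in the Peskun (off-diagonal) ordering: for every x ∈ X and every A ∈ 𝒳, P̄_ω(x, A \ {x}) ≥ P_ω(x, A \ {x}). -/
open MeasureTheory ProbabilityTheory ENNReal

/-- The kernel of Algorithm 1 applied to the Metropolis–Hastings kernels built from the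
proposals `Q_i`, with acceptance probability
`γ_i(x,y) = min(1, (p(y) q_i(y,x)) / (p(x) q_i(x,y))) · min(1, ω_i(y)/ω_i(x))`. -/
noncomputable def algorithm1Kernel {X : Type*} [MeasurableSpace X] {n : ℕ}
    (lam : Measure X) (p : X → ℝ) (q : Fin n → X → X → ℝ) (ω : X → Fin n → ℝ)
    (x : X) (A : Set X) : ℝ≥0∞ :=
  ∑ i : Fin n, ENNReal.ofReal (ω x i) *
    ((∫⁻ y in A, ENNReal.ofReal
        ((min 1 ((p y * q i y x) / (p x * q i x y)) * min 1 (ω y i / ω x i)) * q i x y) ∂lam) +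
      A.indicator (fun _ => (1 : ℝ≥0∞)) x *
        (1 - ∫⁻ y, ENNReal.ofReal
          ((min 1 ((p y * q i y x) / (p x * q i x y)) * min 1 (ω y i / ω x i)) * q i x y) ∂lam))

theorem min_one_mul_min_one_le_min_one_mul {a b : ℝ} (ha : 0 ≤ a) (hb : 0 ≤ b) :
    min 1 a * min 1 b ≤ min 1 (a * b) :=
  le_min (mul_le_one₀ (min_le_left _ _) (le_min zero_le_one hb) (min_le_left _ _))
    (mul_le_mul (min_le_right _ _) (min_le_right _ _) (le_min zero_le_one hb) ha)

/-- In the Metropolis–Hastings density setting, the kernel `P̄_ω` of Algorithm 2 dominates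
the kernel `P_ω` of Algorithm 1 in the Peskun (off-diagonal) ordering:
for every `x` and every measurable `A`, `P̄_ω(x, A \ {x}) ≥ P_ω(x, A \ {x})`. -/
theorem algorithm2_dominates_algorithm1
    {X : Type*} [MeasurableSpace X]
    (lam : Measure X) [SigmaFinite lam]
    (p : X → ℝ) (hpmeas : Measurable p) (hppos : ∀ x, 0 < p x)
    (π : Measure X) [IsProbabilityMeasure π]
    (hπ : π = lam.withDensity fun x => ENNReal.ofReal (p x))
    {n : ℕ} (q : Fin n → X → X → ℝ)
    (hqmeas : ∀ i, Measurable (Function.uncurry (q i)))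
    (hqpos : ∀ i x y, 0 < q i x y)
    (hqmarkov : ∀ i x, ∫⁻ y, ENNReal.ofReal (q i x y) ∂lam = 1)
    (ω : X → Fin n → ℝ)
    (hωmeas : ∀ i : Fin n, Measurable fun x => ω x i)
    (hωpos : ∀ (x : X) (i : Fin n), 0 < ω x i)
    (hωsum : ∀ x : X, ∑ i : Fin n, ω x i = 1) :
    ∀ (x : X) (A : Set X), MeasurableSet A →
      algorithm1Kernel lam p q ω x (A \ {x}) ≤ algorithm2Kernel lam p q ω x (A \ {x}) := by
  intro x A _
  have hx : x ∉ A \ {x} := fun h => h.2 rfl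
  simp only [algorithm1Kernel, algorithm2Kernel, Set.indicator_of_notMem hx, zero_mul, add_zero]
  gcongr with i _ y
  · exact (hqpos i x y).le
  · rw [← div_mul_div_comm (p y * q i y x)]
    exact min_one_mul_min_one_le_min_one_mul
      (div_pos (mul_pos (hppos y) (hqpos i y x)) (mul_pos (hppos x) (hqpos i x y))).le
      (div_pos (hωpos y i) (hωpos x i)).le
end

section
/- For every real p with 0 < p ≤ 1/3, the characteristic polynomial of the 3 × 3 real matrix P*(p) := (1/(2(1−p)(1+p))) · [[2p(1−3p), 2(1−p)², 2p(1+p)], [2(1−p)², 2p(1−3p), 2p(1+p)], [(1−p)(1+p), (1−p)(1+p), 0]] equals (X − 1) · (X + p/(1−p)) · (X + (1 − 3p + 4p²)/(1 − p²)). -/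
open Polynomial

/-- The transition matrix of the locally informed Metropolis–Hastings chain of Example 3
(regime `p ≤ 1/3`). -/
noncomputable def informedMatrix (p : ℝ) : Matrix (Fin 3) (Fin 3) ℝ :=
  (1 / (2 * (1 - p) * (1 + p))) •
    !![2*p*(1 - 3*p), 2*(1 - p)^2, 2*p*(1 + p);
       2*(1 - p)^2, 2*p*(1 - 3*p), 2*p*(1 + p);
       (1 - p)*(1 + p), (1 - p)*(1 + p), 0]

/-- For `0 < p ≤ 1/3`, the characteristic polynomial of the locally informed chain's
transition matrix is `(X − 1)(X + p/(1−p))(X + (1 − 3p + 4p²)/(1 − p²))`. -/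
theorem charpoly_informedMatrix (p : ℝ) (hp : 0 < p) (hp' : p ≤ 1/3) :
    (informedMatrix p).charpoly =
      (X - C 1) * (X + C (p / (1 - p))) * (X + C ((1 - 3*p + 4*p^2) / (1 - p^2))) := by
  have h₁ : 1 - p ≠ 0 := by linarith
  have h₂ : 1 + p ≠ 0 := by linarith
  have h₃ : 1 - p ^ 2 = (1 - p) * (1 + p) := by ring
  refine Polynomial.funext fun x => ?_
  rw [Matrix.eval_charpoly, Matrix.det_fin_three, h₃]
  simp [informedMatrix, Matrix.scalar_apply]
  field_simp
  ring
end

section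
/- Let d ≥ 2 be an even integer and n ≥ 3 an integer, and let Q be the folded RSGS transition matrix on the states {1, …, 2d+1}. If a vector h : {1, …, d} → ℝ satisfies h(i) = 1 + Σ_{j=1}^{d} Q(i, j) h(j) for all i ∈ {1, …, d} (so that h(i) is the expected time for the chain started at i to reach state d+1), then h(1) = ((n−1)/4) d³ + (1/2) d². -/
/-- The folded RSGS transition matrix `Q` on the state space `{1, …, 2d+1}`
(entries outside the state space are set to `0`). With `α = 1/(dn)` and
`β = (n−2)/(dn)`: row 1 and row `2d+1` are the boundary vertex rows, even states
`2k` are the lumped edge interiors, and odd interior states `2k+1` are the vertices. -/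
noncomputable def foldedQ (d n : ℕ) (i j : ℕ) : ℝ :=
  let α : ℝ := 1 / ((d : ℝ) * (n : ℝ))
  let β : ℝ := ((n : ℝ) - 2) / ((d : ℝ) * (n : ℝ))
  if 1 ≤ i ∧ i ≤ 2*d+1 ∧ 1 ≤ j ∧ j ≤ 2*d+1 then
    if i = 1 then
      if j = 2 then β else if j = 3 then α else if j = 1 then 1 - α - β else 0
    else if i = 2*d+1 then
      if j = 2*d then β else if j = 2*d-1 then α else if j = 2*d+1 then 1 - α - β else 0
    else if i % 2 = 0 then
      if j = i-1 then α else if j = i+1 then α else if j = i then 1 - 2*α else 0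
    else
      if j = i-1 then β else if j = i+1 then β
      else if j = i-2 then α else if j = i+2 then α
      else if j = i then 1 - 2*α - 2*β else 0
  else 0

theorem sum_ite_eq_mul_indicator (s : Finset ℕ) (h : ℕ → ℝ) (a : ℕ) (c : ℝ) :
    ∑ j ∈ s, (if j = a then c * h j else 0) = c * (if a ∈ s then h a else 0) := by
  rw [Finset.sum_ite_eq', mul_ite, mul_zero]

/-- The row of `foldedQ` at the boundary vertex, applied to a vector truncated to `{1, …, d}`. -/
theorem sum_foldedQ_one (d n : ℕ) (h : ℕ → ℝ) :
    ∑ j ∈ Finset.Icc 1 d, foldedQ d n 1 j * h j =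
      ((n : ℝ) - 2) / ((d : ℝ) * n) * (if 2 ∈ Finset.Icc 1 d then h 2 else 0)
      + 1 / ((d : ℝ) * n) * (if 3 ∈ Finset.Icc 1 d then h 3 else 0)
      + (1 - 1 / ((d : ℝ) * n) - ((n : ℝ) - 2) / ((d : ℝ) * n))
        * (if 1 ∈ Finset.Icc 1 d then h 1 else 0) := by
  simp only [← sum_ite_eq_mul_indicator, ← Finset.sum_add_distrib]
  refine Finset.sum_congr rfl fun j hj => ?_
  rw [Finset.mem_Icc] at hj
  simp only [foldedQ]
  rw [if_pos (by omega), if_pos trivial]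
  split_ifs <;> first | omega | ring

/-- The row of `foldedQ` at an edge interior, applied to a vector truncated to `{1, …, d}`. -/
theorem sum_foldedQ_even (d n k : ℕ) (hk : 2 * k + 2 ≤ 2 * d) (h : ℕ → ℝ) :
    ∑ j ∈ Finset.Icc 1 d, foldedQ d n (2 * k + 2) j * h j =
      1 / ((d : ℝ) * n) * (if 2 * k + 1 ∈ Finset.Icc 1 d then h (2 * k + 1) else 0)
      + 1 / ((d : ℝ) * n) * (if 2 * k + 3 ∈ Finset.Icc 1 d then h (2 * k + 3) else 0)
      + (1 - 2 * (1 / ((d : ℝ) * n)))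
        * (if 2 * k + 2 ∈ Finset.Icc 1 d then h (2 * k + 2) else 0) := by
  simp only [← sum_ite_eq_mul_indicator, ← Finset.sum_add_distrib]
  refine Finset.sum_congr rfl fun j hj => ?_
  rw [Finset.mem_Icc] at hj
  simp only [foldedQ]
  rw [if_pos (by omega), if_neg (by omega), if_neg (by omega), if_pos (by omega)]
  split_ifs <;> first | omega | ring

/-- The row of `foldedQ` at an interior vertex, applied to a vector truncated to `{1, …, d}`. -/
theorem sum_foldedQ_odd (d n k : ℕ) (hk : 2 * k + 3 ≤ 2 * d) (h : ℕ → ℝ) :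
    ∑ j ∈ Finset.Icc 1 d, foldedQ d n (2 * k + 3) j * h j =
      ((n : ℝ) - 2) / ((d : ℝ) * n)
        * (if 2 * k + 2 ∈ Finset.Icc 1 d then h (2 * k + 2) else 0)
      + ((n : ℝ) - 2) / ((d : ℝ) * n)
        * (if 2 * k + 4 ∈ Finset.Icc 1 d then h (2 * k + 4) else 0)
      + 1 / ((d : ℝ) * n) * (if 2 * k + 1 ∈ Finset.Icc 1 d then h (2 * k + 1) else 0)
      + 1 / ((d : ℝ) * n) * (if 2 * k + 5 ∈ Finset.Icc 1 d then h (2 * k + 5) else 0)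
      + (1 - 2 * (1 / ((d : ℝ) * n)) - 2 * (((n : ℝ) - 2) / ((d : ℝ) * n)))
        * (if 2 * k + 3 ∈ Finset.Icc 1 d then h (2 * k + 3) else 0) := by
  simp only [← sum_ite_eq_mul_indicator, ← Finset.sum_add_distrib]
  refine Finset.sum_congr rfl fun j hj => ?_
  rw [Finset.mem_Icc] at hj
  simp only [foldedQ]
  rw [if_pos (by omega), if_neg (by omega), if_neg (by omega), if_neg (by omega)]
  split_ifs <;> first | omega | ring

/-- Expected hitting time of the middle vertex for the folded RSGS chain: if
`h(i) = 1 + Σ_{j=1}^d Q(i,j) h(j)` for all `i ∈ {1, …, d}`, then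
`h(1) = ((n−1)/4) d³ + (1/2) d²`. -/
theorem foldedQ_hitting_time (d n : ℕ) (hd : 2 ≤ d) (hdeven : Even d) (hn : 3 ≤ n)
    (h : ℕ → ℝ)
    (hh : ∀ i ∈ Finset.Icc 1 d,
      h i = 1 + ∑ j ∈ Finset.Icc 1 d, foldedQ d n i j * h j) :
    h 1 = ((n : ℝ) - 1) / 4 * (d : ℝ)^3 + (1/2) * (d : ℝ)^2 := by
  obtain ⟨m, rfl⟩ := hdeven
  set d := m + m with hd_def
  have hn0 : (n : ℝ) ≠ 0 := by positivity
  have hd0 : (d : ℝ) ≠ 0 := by positivity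
  set g : ℕ → ℝ := fun a => if a ∈ Finset.Icc 1 d then h a else 0 with hg
  have hgh : ∀ i ∈ Finset.Icc 1 d, g i = h i := fun i hi => if_pos hi
  have edge : ∀ k < m, 2 * g (2 * k + 2) = d * n + g (2 * k + 1) + g (2 * k + 3) := by
    intro k hk
    have hmem : 2 * k + 2 ∈ Finset.Icc 1 d := by rw [Finset.mem_Icc]; omega
    have e := (hgh _ hmem).trans (hh _ hmem)
    rw [sum_foldedQ_even d n k (by omega)] at e
    change g (2 * k + 2) = 1 + (_ * g (2 * k + 1) + _ * g (2 * k + 3) + _ * g (2 * k + 2)) at e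
    field_simp at e
    linear_combination e
  have step_zero : g 1 - g 3 = d * n := by
    have hmem : 1 ∈ Finset.Icc 1 d := by rw [Finset.mem_Icc]; omega
    have e := (hgh _ hmem).trans (hh _ hmem)
    rw [sum_foldedQ_one] at e
    change g 1 = 1 + (_ * g 2 + _ * g 3 + _ * g 1) at e
    have e' : 2 * g 2 = d * n + g 1 + g 3 := edge 0 (by omega)
    field_simp at e
    refine mul_left_cancel₀ hn0 ?_
    linear_combination 2 * e + ((n : ℝ) - 2) * e'
  have step_succ : ∀ k, k + 1 < m →
      g (2 * k + 3) - g (2 * k + 5) = g (2 * k + 1) - g (2 * k + 3) + 2 * d * (n - 1) := by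
    intro k hk
    have hmem : 2 * k + 3 ∈ Finset.Icc 1 d := by rw [Finset.mem_Icc]; omega
    have e := (hgh _ hmem).trans (hh _ hmem)
    rw [sum_foldedQ_odd d n k (by omega)] at e
    change g (2 * k + 3) = 1 + (_ * g (2 * k + 2) + _ * g (2 * k + 4) + _ * g (2 * k + 1)
      + _ * g (2 * k + 5) + _ * g (2 * k + 3)) at e
    have e₁ := edge k (by omega)
    have e₂ : 2 * g (2 * k + 4) = d * n + g (2 * k + 3) + g (2 * k + 5) := edge (k + 1) hk
    field_simp at e
    refine mul_left_cancel₀ hn0 ?_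
    linear_combination 2 * e + ((n : ℝ) - 2) * (e₁ + e₂)
  have step : ∀ k < m, g (2 * k + 1) - g (2 * k + 3) = d * n + 2 * d * (n - 1) * k := by
    intro k
    induction k with
    | zero => intro _; simpa using step_zero
    | succ k ih =>
      intro hk
      have e := step_succ k hk
      rw [ih (by omega)] at e
      change g (2 * k + 3) - g (2 * k + 5) = _
      rw [e]
      push_cast
      ring
  have total : ∀ k ≤ m, g 1 - g (2 * k + 1) = d * n * k + d * (n - 1) * (k * (k - 1)) := by
    intro k
    induction k with
    | zero => intro _; simp
    | succ k ih =>
      intro hk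
      have e := ih (by omega)
      have e' := step k (by omega)
      change g 1 - g (2 * k + 3) = _
      push_cast
      linear_combination e + e'
  have hend : g (2 * m + 1) = 0 := if_neg (by rw [Finset.mem_Icc]; omega)
  have e := total m le_rfl
  rw [hend, hgh 1 (by rw [Finset.mem_Icc]; omega)] at e
  have hdm : (d : ℝ) = 2 * m := by rw [hd_def]; push_cast; ring
  rw [hdm] at e ⊢
  linear_combination e
end

section
/- Let d ≥ 2 be an even integer and n ≥ 3 an integer, and let Q* be the folded locally informed transition matrix on the states {1, …, 2d+1}. If a vector h* : {1, …, d} → ℝ satisfies h*(i) = 1 + Σ_{j=1}^{d} Q*(i, j) h*(j) for all i ∈ {1, …, d} (so that h*(i) is the expected time for the chain started at i to reach state d+1), then h*(1) = ((n−1)/2) d² + d. -/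
/-- The folded locally informed transition matrix `Q*` on the state space `{1, …, 2d+1}`
(entries outside the state space are set to `0`). With `α* = 1/(2n)`, `ᾱ* = 1/n`,
`β* = (n−2)/(2n)` and `β̄* = (n−2)/n`. -/
noncomputable def foldedQstar (d n : ℕ) (i j : ℕ) : ℝ :=
  let a : ℝ := 1 / (2 * (n : ℝ))          -- α*
  let ab : ℝ := 1 / (n : ℝ)               -- ᾱ*
  let b : ℝ := ((n : ℝ) - 2) / (2 * (n : ℝ)) -- β*
  let bb : ℝ := ((n : ℝ) - 2) / (n : ℝ)      -- β̄*
  if 1 ≤ i ∧ i ≤ 2*d+1 ∧ 1 ≤ j ∧ j ≤ 2*d+1 then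
    if i = 1 then
      if j = 2 then bb else if j = 3 then a else if j = 1 then 1 - a - bb else 0
    else if i = 2*d+1 then
      if j = 2*d then bb else if j = 2*d-1 then a else if j = 2*d+1 then 1 - a - bb else 0
    else if i = 2 then
      if j = 1 then ab else if j = 3 then a else if j = 2 then 1 - ab - a else 0
    else if i = 2*d then
      if j = 2*d+1 then ab else if j = 2*d-1 then a else if j = 2*d then 1 - ab - a else 0
    else if i % 2 = 0 then
      if j = i-1 then a else if j = i+1 then a else if j = i then 1 - 2*a else 0
    else
      if j = i-1 then b else if j = i+1 then b
      else if j = i-2 then a else if j = i+2 then a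
      else if j = i then 1 - 2*a - 2*b else 0
  else 0

/-- The vector `h` on `{1, …, d}`, extended by `0`. -/
noncomputable def killedExtension (d : ℕ) (h : ℕ → ℝ) (j : ℕ) : ℝ :=
  if j ∈ Finset.Icc 1 d then h j else 0

lemma killedExtension_of_lt {d j : ℕ} (h : ℕ → ℝ) (hj : d < j) : killedExtension d h j = 0 :=
  if_neg fun hm => by have := Finset.mem_Icc.1 hm; omega

lemma killedExtension_of_mem {d j : ℕ} (h : ℕ → ℝ) (hj : j ∈ Finset.Icc 1 d) :
    killedExtension d h j = h j :=
  if_pos hj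

lemma sum_pointMass_mul (d p : ℕ) (c : ℝ) (h : ℕ → ℝ) :
    ∑ j ∈ Finset.Icc 1 d, (if j = p then c else 0) * h j = c * killedExtension d h p := by
  simp only [ite_mul, zero_mul, Finset.sum_ite_eq', killedExtension, mul_ite, mul_zero]

lemma sum_foldedQstar_one_mul {d n : ℕ} (hd : 2 ≤ d) (h : ℕ → ℝ) :
    ∑ j ∈ Finset.Icc 1 d, foldedQstar d n 1 j * h j =
      ((n : ℝ) - 2) / n * killedExtension d h 2 + 1 / (2 * (n : ℝ)) * killedExtension d h 3 +
        (1 - 1 / (2 * (n : ℝ)) - ((n : ℝ) - 2) / n) * killedExtension d h 1 := by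
  simp only [← sum_pointMass_mul, ← Finset.sum_add_distrib, ← add_mul]
  refine Finset.sum_congr rfl fun j hj => ?_
  obtain ⟨h1, h2⟩ := Finset.mem_Icc.1 hj
  congr 1
  simp only [foldedQstar, if_pos (show 1 ≤ 1 ∧ 1 ≤ 2 * d + 1 ∧ 1 ≤ j ∧ j ≤ 2 * d + 1 by omega), if_true]
  split_ifs <;> first | omega | ring

lemma sum_foldedQstar_two_mul {d n : ℕ} (hd : 2 ≤ d) (h : ℕ → ℝ) :
    ∑ j ∈ Finset.Icc 1 d, foldedQstar d n 2 j * h j =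
      1 / (n : ℝ) * killedExtension d h 1 + 1 / (2 * (n : ℝ)) * killedExtension d h 3 +
        (1 - 1 / (n : ℝ) - 1 / (2 * (n : ℝ))) * killedExtension d h 2 := by
  simp only [← sum_pointMass_mul, ← Finset.sum_add_distrib, ← add_mul]
  refine Finset.sum_congr rfl fun j hj => ?_
  obtain ⟨h1, h2⟩ := Finset.mem_Icc.1 hj
  congr 1
  simp only [foldedQstar, if_pos (show 1 ≤ 2 ∧ 2 ≤ 2 * d + 1 ∧ 1 ≤ j ∧ j ≤ 2 * d + 1 by omega),
    show ¬((2 : ℕ) = 1) by omega,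
    show ¬(2 = 2 * d + 1) by omega, if_true, if_false]
  split_ifs <;> first | omega | ring

lemma sum_foldedQstar_even_mul {d n k : ℕ} (hk : 1 ≤ k) (hkd : 2 * k + 2 ≤ d) (h : ℕ → ℝ) :
    ∑ j ∈ Finset.Icc 1 d, foldedQstar d n (2 * k + 2) j * h j =
      1 / (2 * (n : ℝ)) * killedExtension d h (2 * k + 1) +
        1 / (2 * (n : ℝ)) * killedExtension d h (2 * k + 3) +
        (1 - 2 * (1 / (2 * (n : ℝ)))) * killedExtension d h (2 * k + 2) := by
  simp only [← sum_pointMass_mul, ← Finset.sum_add_distrib, ← add_mul]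
  refine Finset.sum_congr rfl fun j hj => ?_
  obtain ⟨h1, h2⟩ := Finset.mem_Icc.1 hj
  congr 1
  simp only [foldedQstar, if_pos (show 1 ≤ 2 * k + 2 ∧ 2 * k + 2 ≤ 2 * d + 1 ∧ 1 ≤ j ∧ j ≤ 2 * d + 1 by omega),
    show ¬(2 * k + 2 = 1) by omega,
    show ¬(2 * k + 2 = 2 * d + 1) by omega,
    show ¬(2 * k + 2 = 2) by omega,
    show ¬(2 * k + 2 = 2 * d) by omega,
    show (2 * k + 2) % 2 = 0 by omega,
    show 2 * k + 2 - 1 = 2 * k + 1 by omega,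
    show 2 * k + 2 + 1 = 2 * k + 3 by omega, if_true, if_false]
  split_ifs <;> first | omega | ring

lemma sum_foldedQstar_odd_mul {d n k : ℕ} (hkd : 2 * k + 3 ≤ d) (h : ℕ → ℝ) :
    ∑ j ∈ Finset.Icc 1 d, foldedQstar d n (2 * k + 3) j * h j =
      ((n : ℝ) - 2) / (2 * n) * killedExtension d h (2 * k + 2) +
        ((n : ℝ) - 2) / (2 * n) * killedExtension d h (2 * k + 4) +
        1 / (2 * (n : ℝ)) * killedExtension d h (2 * k + 1) +
        1 / (2 * (n : ℝ)) * killedExtension d h (2 * k + 5) +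
        (1 - 2 * (1 / (2 * (n : ℝ))) - 2 * (((n : ℝ) - 2) / (2 * n))) *
          killedExtension d h (2 * k + 3) := by
  simp only [← sum_pointMass_mul, ← Finset.sum_add_distrib, ← add_mul]
  refine Finset.sum_congr rfl fun j hj => ?_
  obtain ⟨h1, h2⟩ := Finset.mem_Icc.1 hj
  congr 1
  simp only [foldedQstar, if_pos (show 1 ≤ 2 * k + 3 ∧ 2 * k + 3 ≤ 2 * d + 1 ∧ 1 ≤ j ∧ j ≤ 2 * d + 1 by omega),
    show ¬(2 * k + 3 = 1) by omega,
    show ¬(2 * k + 3 = 2 * d + 1) by omega,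
    show ¬(2 * k + 3 = 2) by omega,
    show ¬(2 * k + 3 = 2 * d) by omega,
    show ¬((2 * k + 3) % 2 = 0) by omega,
    show 2 * k + 3 - 1 = 2 * k + 2 by omega,
    show 2 * k + 3 + 1 = 2 * k + 4 by omega,
    show 2 * k + 3 - 2 = 2 * k + 1 by omega,
    show 2 * k + 3 + 2 = 2 * k + 5 by omega, if_false]
  split_ifs <;> first | omega | ring

/-- A solution of the folded hitting-time equations, written with denominators cleared, drops by
`2x + 4(x-1)k` from the vertex `2k+1` to the vertex `2k+3`. -/
lemma vertex_drop_of_hitting_equations {m : ℕ} {x : ℝ} (hx : 2 ≤ x) (g : ℕ → ℝ)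
    (h_one : 2 * (x - 2) * (g 1 - g 2) + (g 1 - g 3) = 2 * x)
    (h_two : 2 * (g 2 - g 1) + (g 2 - g 3) = 2 * x)
    (h_even : ∀ k, 1 ≤ k → k < m →
      (g (2 * k + 2) - g (2 * k + 1)) + (g (2 * k + 2) - g (2 * k + 3)) = 2 * x)
    (h_odd : ∀ k, k + 1 < m →
      (x - 2) * (g (2 * k + 3) - g (2 * k + 2)) + (x - 2) * (g (2 * k + 3) - g (2 * k + 4)) +
        (g (2 * k + 3) - g (2 * k + 1)) + (g (2 * k + 3) - g (2 * k + 5)) = 2 * x) :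
    ∀ k < m, g (2 * k + 1) - g (2 * k + 3) = 2 * x + 4 * (x - 1) * k := by
  have h_first : g 1 - g 3 = 2 * x := by
    have hne : 2 * x - 1 ≠ 0 := by linarith
    apply mul_left_cancel₀ hne
    linear_combination 3 * h_one + 2 * (x - 2) * h_two
  intro k
  induction k with
  | zero => intro _; simpa using h_first
  | succ k ih =>
    intro hk
    have hdrop := ih (by omega)
    have hodd := h_odd k hk
    have heven := h_even (k + 1) (by omega) hk
    simp only [mul_add, mul_one, add_assoc, Nat.reduceAdd] at heven ⊢
    push_cast
    apply mul_left_cancel₀ (show x ≠ 0 by linarith)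
    rcases Nat.eq_zero_or_pos k with rfl | hkpos
    · simp only [mul_zero, zero_add, Nat.cast_zero, add_zero] at *
      have h_edge : g 2 = g 1 := by linarith
      rw [h_edge] at hodd
      linear_combination 2 * hodd + (x - 2) * heven + (2 * x - 2) * h_first
    · have heven' := h_even k hkpos (by omega)
      linear_combination 2 * hodd + (x - 2) * heven + (x - 2) * heven' + x * hdrop

/-- Expected hitting time of the middle vertex for the folded locally informed chain: if
`h*(i) = 1 + Σ_{j=1}^d Q*(i,j) h*(j)` for all `i ∈ {1, …, d}`, then
`h*(1) = ((n−1)/2) d² + d`. -/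
theorem foldedQstar_hitting_time (d n : ℕ) (hd : 2 ≤ d) (hdeven : Even d) (hn : 3 ≤ n)
    (hstar : ℕ → ℝ)
    (hh : ∀ i ∈ Finset.Icc 1 d,
      hstar i = 1 + ∑ j ∈ Finset.Icc 1 d, foldedQstar d n i j * hstar j) :
    hstar 1 = ((n : ℝ) - 1) / 2 * (d : ℝ)^2 + (d : ℝ) := by
  obtain ⟨m, rfl⟩ := even_iff_exists_two_mul.1 hdeven
  have hn' : (3 : ℝ) ≤ n := by exact_mod_cast hn
  have hn0 : (n : ℝ) ≠ 0 := by positivity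
  set g := killedExtension (2 * m) hstar with hg
  have hrow : ∀ i ∈ Finset.Icc 1 (2 * m),
      g i = 1 + ∑ j ∈ Finset.Icc 1 (2 * m), foldedQstar (2 * m) n i j * hstar j :=
    fun i hi => (killedExtension_of_mem hstar hi).trans (hh i hi)
  have hdrop := vertex_drop_of_hitting_equations (m := m) (x := n) (by linarith) g
    (by
      have h := hrow 1 (Finset.mem_Icc.2 (by omega))
      rw [sum_foldedQstar_one_mul hd, ← hg] at h
      field_simp at h
      linear_combination h)
    (by
      have h := hrow 2 (Finset.mem_Icc.2 (by omega))
      rw [sum_foldedQstar_two_mul hd, ← hg] at h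
      field_simp at h
      linear_combination h)
    (by
      intro k hk hkm
      have h := hrow (2 * k + 2) (Finset.mem_Icc.2 (by omega))
      rw [sum_foldedQstar_even_mul hk (by omega), ← hg] at h
      field_simp at h
      linear_combination h)
    (by
      intro k hkm
      have h := hrow (2 * k + 3) (Finset.mem_Icc.2 (by omega))
      rw [sum_foldedQstar_odd_mul (by omega), ← hg] at h
      field_simp at h
      linear_combination h)
  have hvertex : ∀ k ≤ m, g 1 - g (2 * k + 1) = 2 * n * k + 2 * ((n : ℝ) - 1) * k * (k - 1) := by
    intro k
    induction k with
    | zero => intro _; simp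
    | succ k ih =>
      intro hk
      have hstep := hdrop k (by omega)
      have hprev := ih (by omega)
      rw [show 2 * (k + 1) + 1 = 2 * k + 3 by ring]
      push_cast
      linear_combination hstep + hprev
  have hlast := hvertex m le_rfl
  rw [hg, killedExtension_of_lt hstar (Nat.lt_succ_self _),
    killedExtension_of_mem hstar (Finset.mem_Icc.2 (by omega))] at hlast
  push_cast
  linear_combination hlast
end

section
/- Let d ≥ 2 be an even integer and n ≥ 3 an integer. Let Q be the folded RSGS transition matrix and Q* the folded locally informed transition matrix on {1, …, 2d+1}. If h, h* : {1, …, d} → ℝ satisfy h(i) = 1 + Σ_{j=1}^{d} Q(i, j) h(j) and h*(i) = 1 + Σ_{j=1}^{d} Q*(i, j) h*(j) for all i ∈ {1, …, d}, then h(1) = (d/2) · h*(1); that is, the expected time for the random-scan Gibbs sampler to reach the middle vertex of the filament from one extremity is d/2 times the corresponding expected time for the locally informed sampler. -/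
/-- A sum of `q j * h j` over `{1, …, d}` may be computed on any finset containing the support
of `q`, once `h` is extended by zero. -/
theorem sum_Icc_mul_eq_sum_indicator (d : ℕ) (q h : ℕ → ℝ) (s : Finset ℕ)
    (hq : ∀ j ∉ s, q j = 0) :
    ∑ j ∈ Finset.Icc 1 d, q j * h j
      = ∑ j ∈ s, q j * (Set.Icc 1 d).indicator h j := by
  classical
  have hsum : ∑ j ∈ Finset.Icc 1 d, q j * h j
      = ∑ j ∈ Finset.Icc 1 d, q j * (Set.Icc 1 d).indicator h j :=
    Finset.sum_congr rfl fun j hj => by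
      rw [Set.indicator_of_mem (by simpa using hj)]
  rw [hsum, Finset.sum_subset (s₂ := Finset.Icc 1 d ∪ s) Finset.subset_union_left,
    Finset.sum_subset (s₁ := s) (s₂ := Finset.Icc 1 d ∪ s) Finset.subset_union_right]
  · intro j _ hj
    rw [hq j hj, zero_mul]
  · intro j _ hj
    rw [Set.indicator_of_notMem (by simpa using hj), mul_zero]

/-- The hitting-time system is determined at the extremity by its first two increments and the
interior rows; here `T` is the common time scale. -/
theorem eq_mul_sum_of_filament_recurrence (m : ℕ) (n T : ℝ) (hn : 0 < n) (f : ℕ → ℝ)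
    (hend : f (2 * m + 1) = 0) (h13 : f 1 - f 3 = T) (h23 : f 2 - f 3 = T)
    (heven : ∀ k, k + 1 < m → 2 * f (2 * k + 4) = T + f (2 * k + 3) + f (2 * k + 5))
    (hodd : ∀ k, k + 1 < m →
      (n - 2) * (f (2 * k + 2) + f (2 * k + 4) - 2 * f (2 * k + 3))
        + (f (2 * k + 1) + f (2 * k + 5) - 2 * f (2 * k + 3)) = -T) :
    f 1 = ∑ k ∈ Finset.range m, T * (1 + k * (2 * (n - 1) / n)) := by
  have key : ∀ k, k < m →
      f (2 * k + 1) - f (2 * k + 3) = T * (1 + k * (2 * (n - 1) / n)) ∧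
      f (2 * k + 2) - f (2 * k + 3) = T * (1 + k * ((n - 1) / n)) := by
    intro k
    induction k with
    | zero => intro _; simpa using ⟨h13, h23⟩
    | succ k ih =>
      intro hk
      obtain ⟨h₁, h₂⟩ := ih (by omega)
      have he := heven k hk
      have ho := hodd k hk
      have hD : f (2 * k + 3) - f (2 * k + 5) = T * (1 + (k + 1) * (2 * (n - 1) / n)) := by
        have hr : n * ((n - 1) / n) = n - 1 := by field_simp
        rw [mul_div_assoc] at h₁ ⊢
        generalize (n - 1) / n = r at *
        apply mul_left_cancel₀ hn.ne'
        linear_combination (-2) * ho + 2 * h₁ + 2 * (n - 2) * h₂ + (n - 2) * he - 2 * T * hr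
      have hE : f (2 * k + 4) - f (2 * k + 5) = T * (1 + (k + 1) * ((n - 1) / n)) := by
        rw [mul_div_assoc] at hD
        linear_combination he / 2 + hD / 2
      push_cast
      exact ⟨hD, hE⟩
  calc f 1 = f (2 * 0 + 1) - f (2 * m + 1) := by simp [hend]
    _ = ∑ k ∈ Finset.range m, (f (2 * k + 1) - f (2 * (k + 1) + 1)) :=
      (Finset.sum_range_sub' (fun k => f (2 * k + 1)) m).symm
    _ = _ := Finset.sum_congr rfl fun k hk => (key k (Finset.mem_range.mp hk)).1

section Rows

variable {d n : ℕ} {h f : ℕ → ℝ}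

theorem foldedQ_row_one (hd : 2 ≤ d) (hn : 3 ≤ n) (hf : f = (Set.Icc 1 d).indicator h)
    (hh : h 1 = 1 + ∑ j ∈ Finset.Icc 1 d, foldedQ d n 1 j * h j) :
    ((n : ℝ) - 2) * (f 2 - f 1) + (f 3 - f 1) = -(d * n) := by
  have h₁ : f 1 = h 1 := by rw [hf]; exact Set.indicator_of_mem (Set.mem_Icc.mpr ⟨by omega, by omega⟩) h
  rw [sum_Icc_mul_eq_sum_indicator d _ h {1, 2, 3}, ← hf, ← h₁] at hh
  · have q₁ : foldedQ d n 1 1 = 1 - 1 / (d * n) - ((n : ℝ) - 2) / (d * n) := by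
      simp (disch := omega) only [foldedQ, if_pos, if_neg, if_true]
    have q₂ : foldedQ d n 1 2 = ((n : ℝ) - 2) / (d * n) := by
      simp (disch := omega) only [foldedQ, if_pos, if_neg, if_true]
    have q₃ : foldedQ d n 1 3 = 1 / (d * n) := by
      simp (disch := omega) only [foldedQ, if_pos, if_neg, if_true]
    have hd₀ : (d : ℝ) ≠ 0 := by positivity
    have hn₀ : (n : ℝ) ≠ 0 := by positivity
    simp [q₁, q₂, q₃] at hh
    field_simp at hh
    linear_combination -hh
  · intro j hj
    simp only [Finset.mem_insert, Finset.mem_singleton, not_or] at hj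
    simp (disch := omega) only [foldedQ, if_neg, ite_self]

theorem foldedQ_row_even (hd : 2 ≤ d) (hn : 3 ≤ n) (hf : f = (Set.Icc 1 d).indicator h)
    (k : ℕ) (hk : 2 * k + 2 ≤ d)
    (hh : h (2 * k + 2) = 1 + ∑ j ∈ Finset.Icc 1 d, foldedQ d n (2 * k + 2) j * h j) :
    2 * f (2 * k + 2) = d * n + f (2 * k + 1) + f (2 * k + 3) := by
  have h₁ : f (2 * k + 2) = h (2 * k + 2) := by
    rw [hf]; exact Set.indicator_of_mem (Set.mem_Icc.mpr ⟨by omega, by omega⟩) h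
  rw [sum_Icc_mul_eq_sum_indicator d _ h {2 * k + 1, 2 * k + 2, 2 * k + 3}, ← hf, ← h₁] at hh
  · have q₁ : foldedQ d n (2 * k + 2) (2 * k + 1) = 1 / (d * n) := by
      simp (disch := omega) only [foldedQ, if_pos, if_neg]
    have q₂ : foldedQ d n (2 * k + 2) (2 * k + 2) = 1 - 2 * (1 / (d * n)) := by
      simp (disch := omega) only [foldedQ, if_pos, if_neg, if_true]
    have q₃ : foldedQ d n (2 * k + 2) (2 * k + 3) = 1 / (d * n) := by
      simp (disch := omega) only [foldedQ, if_pos, if_neg, if_true]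
    have hd₀ : (d : ℝ) ≠ 0 := by positivity
    have hn₀ : (n : ℝ) ≠ 0 := by positivity
    simp [q₁, q₂, q₃] at hh
    field_simp at hh
    linear_combination hh
  · intro j hj
    simp only [Finset.mem_insert, Finset.mem_singleton, not_or] at hj
    simp (disch := omega) only [foldedQ, if_neg, ite_self]

theorem foldedQ_row_odd (hd : 2 ≤ d) (hn : 3 ≤ n) (hf : f = (Set.Icc 1 d).indicator h)
    (k : ℕ) (hk : 2 * k + 3 ≤ d)
    (hh : h (2 * k + 3) = 1 + ∑ j ∈ Finset.Icc 1 d, foldedQ d n (2 * k + 3) j * h j) :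
    ((n : ℝ) - 2) * (f (2 * k + 2) + f (2 * k + 4) - 2 * f (2 * k + 3))
      + (f (2 * k + 1) + f (2 * k + 5) - 2 * f (2 * k + 3)) = -(d * n) := by
  have h₁ : f (2 * k + 3) = h (2 * k + 3) := by
    rw [hf]; exact Set.indicator_of_mem (Set.mem_Icc.mpr ⟨by omega, by omega⟩) h
  rw [sum_Icc_mul_eq_sum_indicator d _ h
    {2 * k + 1, 2 * k + 2, 2 * k + 3, 2 * k + 4, 2 * k + 5}, ← hf, ← h₁] at hh
  · have q₁ : foldedQ d n (2 * k + 3) (2 * k + 1) = 1 / (d * n) := by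
      simp (disch := omega) only [foldedQ, if_pos, if_neg]
    have q₂ : foldedQ d n (2 * k + 3) (2 * k + 2) = ((n : ℝ) - 2) / (d * n) := by
      simp (disch := omega) only [foldedQ, if_pos, if_neg]
    have q₃ : foldedQ d n (2 * k + 3) (2 * k + 3)
        = 1 - 2 * (1 / (d * n)) - 2 * (((n : ℝ) - 2) / (d * n)) := by
      simp (disch := omega) only [foldedQ, if_pos, if_neg, if_true]
    have q₄ : foldedQ d n (2 * k + 3) (2 * k + 4) = ((n : ℝ) - 2) / (d * n) := by
      simp (disch := omega) only [foldedQ, if_pos, if_neg, if_true]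
    have q₅ : foldedQ d n (2 * k + 3) (2 * k + 5) = 1 / (d * n) := by
      simp (disch := omega) only [foldedQ, if_pos, if_neg, if_true]
    have hd₀ : (d : ℝ) ≠ 0 := by positivity
    have hn₀ : (n : ℝ) ≠ 0 := by positivity
    simp [q₁, q₂, q₃, q₄, q₅] at hh
    field_simp at hh
    linear_combination -hh
  · intro j hj
    simp only [Finset.mem_insert, Finset.mem_singleton, not_or] at hj
    simp (disch := omega) only [foldedQ, if_neg, ite_self]

theorem foldedQstar_row_one (hd : 2 ≤ d) (hn : 3 ≤ n) (hf : f = (Set.Icc 1 d).indicator h)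
    (hh : h 1 = 1 + ∑ j ∈ Finset.Icc 1 d, foldedQstar d n 1 j * h j) :
    2 * ((n : ℝ) - 2) * (f 2 - f 1) + (f 3 - f 1) = -(2 * n) := by
  have h₁ : f 1 = h 1 := by rw [hf]; exact Set.indicator_of_mem (Set.mem_Icc.mpr ⟨by omega, by omega⟩) h
  rw [sum_Icc_mul_eq_sum_indicator d _ h {1, 2, 3}, ← hf, ← h₁] at hh
  · have q₁ : foldedQstar d n 1 1 = 1 - 1 / (2 * n) - ((n : ℝ) - 2) / n := by
      simp (disch := omega) only [foldedQstar, if_pos, if_neg, if_true]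
    have q₂ : foldedQstar d n 1 2 = ((n : ℝ) - 2) / n := by
      simp (disch := omega) only [foldedQstar, if_pos, if_neg, if_true]
    have q₃ : foldedQstar d n 1 3 = 1 / (2 * n) := by
      simp (disch := omega) only [foldedQstar, if_pos, if_neg, if_true]
    have hn₀ : (n : ℝ) ≠ 0 := by positivity
    simp [q₁, q₂, q₃] at hh
    field_simp at hh
    linear_combination -hh
  · intro j hj
    simp only [Finset.mem_insert, Finset.mem_singleton, not_or] at hj
    simp (disch := omega) only [foldedQstar, if_neg, ite_self]

theorem foldedQstar_row_two (hd : 2 ≤ d) (hn : 3 ≤ n) (hf : f = (Set.Icc 1 d).indicator h)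
    (hh : h 2 = 1 + ∑ j ∈ Finset.Icc 1 d, foldedQstar d n 2 j * h j) :
    3 * f 2 = 2 * n + 2 * f 1 + f 3 := by
  have h₁ : f 2 = h 2 := by rw [hf]; exact Set.indicator_of_mem (Set.mem_Icc.mpr ⟨by omega, by omega⟩) h
  rw [sum_Icc_mul_eq_sum_indicator d _ h {1, 2, 3}, ← hf, ← h₁] at hh
  · have q₁ : foldedQstar d n 2 1 = 1 / n := by
      simp (disch := omega) only [foldedQstar, if_pos, if_neg, if_true]
    have q₂ : foldedQstar d n 2 2 = 1 - 1 / n - 1 / (2 * n) := by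
      simp (disch := omega) only [foldedQstar, if_pos, if_neg, if_true]
    have q₃ : foldedQstar d n 2 3 = 1 / (2 * n) := by
      simp (disch := omega) only [foldedQstar, if_pos, if_neg, if_true]
    have hn₀ : (n : ℝ) ≠ 0 := by positivity
    simp [q₁, q₂, q₃] at hh
    field_simp at hh
    linear_combination hh
  · intro j hj
    simp only [Finset.mem_insert, Finset.mem_singleton, not_or] at hj
    simp (disch := omega) only [foldedQstar, if_neg, ite_self, if_true]

theorem foldedQstar_row_even (hn : 3 ≤ n) (hf : f = (Set.Icc 1 d).indicator h)
    (k : ℕ) (hk : 2 * k + 4 ≤ d)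
    (hh : h (2 * k + 4) = 1 + ∑ j ∈ Finset.Icc 1 d, foldedQstar d n (2 * k + 4) j * h j) :
    2 * f (2 * k + 4) = 2 * n + f (2 * k + 3) + f (2 * k + 5) := by
  have h₁ : f (2 * k + 4) = h (2 * k + 4) := by
    rw [hf]; exact Set.indicator_of_mem (Set.mem_Icc.mpr ⟨by omega, by omega⟩) h
  rw [sum_Icc_mul_eq_sum_indicator d _ h {2 * k + 3, 2 * k + 4, 2 * k + 5}, ← hf, ← h₁] at hh
  · have q₁ : foldedQstar d n (2 * k + 4) (2 * k + 3) = 1 / (2 * n) := by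
      simp (disch := omega) only [foldedQstar, if_pos, if_neg]
    have q₂ : foldedQstar d n (2 * k + 4) (2 * k + 4) = 1 - 2 * (1 / (2 * n)) := by
      simp (disch := omega) only [foldedQstar, if_pos, if_neg, if_true]
    have q₃ : foldedQstar d n (2 * k + 4) (2 * k + 5) = 1 / (2 * n) := by
      simp (disch := omega) only [foldedQstar, if_pos, if_neg, if_true]
    have hn₀ : (n : ℝ) ≠ 0 := by positivity
    simp [q₁, q₂, q₃] at hh
    field_simp at hh
    linear_combination hh
  · intro j hj
    simp only [Finset.mem_insert, Finset.mem_singleton, not_or] at hj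
    simp (disch := omega) only [foldedQstar, if_neg, ite_self]

theorem foldedQstar_row_odd (hn : 3 ≤ n) (hf : f = (Set.Icc 1 d).indicator h)
    (k : ℕ) (hk : 2 * k + 3 ≤ d)
    (hh : h (2 * k + 3) = 1 + ∑ j ∈ Finset.Icc 1 d, foldedQstar d n (2 * k + 3) j * h j) :
    ((n : ℝ) - 2) * (f (2 * k + 2) + f (2 * k + 4) - 2 * f (2 * k + 3))
      + (f (2 * k + 1) + f (2 * k + 5) - 2 * f (2 * k + 3)) = -(2 * n) := by
  have h₁ : f (2 * k + 3) = h (2 * k + 3) := by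
    rw [hf]; exact Set.indicator_of_mem (Set.mem_Icc.mpr ⟨by omega, by omega⟩) h
  rw [sum_Icc_mul_eq_sum_indicator d _ h
    {2 * k + 1, 2 * k + 2, 2 * k + 3, 2 * k + 4, 2 * k + 5}, ← hf, ← h₁] at hh
  · have q₁ : foldedQstar d n (2 * k + 3) (2 * k + 1) = 1 / (2 * n) := by
      simp (disch := omega) only [foldedQstar, if_pos, if_neg]
    have q₂ : foldedQstar d n (2 * k + 3) (2 * k + 2) = ((n : ℝ) - 2) / (2 * n) := by
      simp (disch := omega) only [foldedQstar, if_pos, if_neg]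
    have q₃ : foldedQstar d n (2 * k + 3) (2 * k + 3)
        = 1 - 2 * (1 / (2 * n)) - 2 * (((n : ℝ) - 2) / (2 * n)) := by
      simp (disch := omega) only [foldedQstar, if_pos, if_neg, if_true]
    have q₄ : foldedQstar d n (2 * k + 3) (2 * k + 4) = ((n : ℝ) - 2) / (2 * n) := by
      simp (disch := omega) only [foldedQstar, if_pos, if_neg, if_true]
    have q₅ : foldedQstar d n (2 * k + 3) (2 * k + 5) = 1 / (2 * n) := by
      simp (disch := omega) only [foldedQstar, if_pos, if_neg, if_true]
    have hn₀ : (n : ℝ) ≠ 0 := by positivity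
    simp [q₁, q₂, q₃, q₄, q₅] at hh
    field_simp at hh
    linear_combination -hh
  · intro j hj
    simp only [Finset.mem_insert, Finset.mem_singleton, not_or] at hj
    simp (disch := omega) only [foldedQstar, if_neg, ite_self]

end Rows

/-- The expected time for the random-scan Gibbs sampler to reach the middle vertex of the
filament from one extremity is `d/2` times the corresponding expected time for the locally
informed sampler: if `h(i) = 1 + Σ_{j=1}^d Q(i,j) h(j)` and
`h*(i) = 1 + Σ_{j=1}^d Q*(i,j) h*(j)` for all `i ∈ {1, …, d}`, then `h(1) = (d/2) h*(1)`. -/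
theorem foldedQ_hitting_time_ratio (d n : ℕ) (hd : 2 ≤ d) (hdeven : Even d) (hn : 3 ≤ n)
    (h hstar : ℕ → ℝ)
    (hh : ∀ i ∈ Finset.Icc 1 d,
      h i = 1 + ∑ j ∈ Finset.Icc 1 d, foldedQ d n i j * h j)
    (hhstar : ∀ i ∈ Finset.Icc 1 d,
      hstar i = 1 + ∑ j ∈ Finset.Icc 1 d, foldedQstar d n i j * hstar j) :
    h 1 = ((d : ℝ) / 2) * hstar 1 := by
  obtain ⟨m, rfl⟩ := hdeven.two_dvd
  have hn₀ : (3 : ℝ) ≤ n := by exact_mod_cast hn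
  have hmem {i : ℕ} (h₁ : 1 ≤ i) (h₂ : i ≤ 2 * m) : i ∈ Finset.Icc 1 (2 * m) :=
    Finset.mem_Icc.mpr ⟨h₁, h₂⟩
  have hext (g : ℕ → ℝ) : (Set.Icc 1 (2 * m)).indicator g 1 = g 1 :=
    Set.indicator_of_mem (Set.mem_Icc.mpr ⟨le_rfl, by omega⟩) g
  have hend (g : ℕ → ℝ) : (Set.Icc 1 (2 * m)).indicator g (2 * m + 1) = 0 :=
    Set.indicator_of_notMem (by simp) g
  have hQ := eq_mul_sum_of_filament_recurrence m n ((2 * m : ℕ) * n) (by linarith) _ (hend h)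
  have hQstar := eq_mul_sum_of_filament_recurrence m n (2 * n) (by linarith) _ (hend hstar)
  have r₁ := foldedQ_row_one hd hn rfl (hh 1 (hmem le_rfl (by omega)))
  have r₂ := foldedQ_row_even hd hn rfl 0 hd (hh 2 (hmem (by omega) hd))
  have s₁ := foldedQstar_row_one hd hn rfl (hhstar 1 (hmem le_rfl (by omega)))
  have s₂ := foldedQstar_row_two hd hn rfl (hhstar 2 (hmem (by omega) hd))
  simp only [mul_zero, zero_add] at r₂
  have r₁₃ : (Set.Icc 1 (2 * m)).indicator h 1 - (Set.Icc 1 (2 * m)).indicator h 3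
      = (2 * m : ℕ) * n := by
    apply mul_left_cancel₀ (show (n : ℝ) ≠ 0 by linarith)
    linear_combination (-2) * r₁ + ((n : ℝ) - 2) * r₂
  have s₁₃ : (Set.Icc 1 (2 * m)).indicator hstar 1 - (Set.Icc 1 (2 * m)).indicator hstar 3
      = 2 * n := by
    apply mul_left_cancel₀ (show (2 * n - 1 : ℝ) ≠ 0 by linarith)
    linear_combination (-3) * s₁ + 2 * ((n : ℝ) - 2) * s₂
  have hQ := hQ r₁₃ (by linear_combination (r₂ + r₁₃) / 2)
    (fun k hk => foldedQ_row_even hd hn rfl (k + 1) (by omega)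
      (hh _ (hmem (by omega) (by omega))))
    (fun k hk => foldedQ_row_odd hd hn rfl k (by omega) (hh _ (hmem (by omega) (by omega))))
  have hQstar := hQstar s₁₃ (by linear_combination (s₂ + 2 * s₁₃) / 3)
    (fun k hk => foldedQstar_row_even hn rfl k (by omega) (hhstar _ (hmem (by omega) (by omega))))
    (fun k hk => foldedQstar_row_odd hn rfl k (by omega) (hhstar _ (hmem (by omega) (by omega))))
  rw [hext, ← Finset.mul_sum] at hQ hQstar
  rw [hQ, hQstar]
  ring
end
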